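/- arXiv:1604.06429 — 3 statements merged into one kernel-verified Lean document; each statement's English description precedes it below -/
import Mathlib

section
/- Let ξ = e^{2πi/5}, φ = (1 + √5)/2, ρ(σ₁) = [[ξ⁻², 0], [0, −ξ⁻¹]] and ρ(σ₂) = [[φ⁻¹·ξ², −φ^{−1/2}·ξ], [−φ^{−1/2}·ξ, −φ⁻¹]], which are unitary 2×2 matrices. Then the topological closure (in the space of 2×2 complex matrices) of the subgroup of the unitary group U(2) generated by ρ(σ₁) and ρ(σ₂) contains the special unitary group SU(2): every 2×2 unitary matrix of determinant 1 is a limit of products of ρ(σ₁)^{±1} and ρ(σ₂)^{±1}. -/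
open Matrix

/-- `ξ = e^{2πi/5}`. -/
noncomputable def ξ : ℂ := Complex.exp (2 * Real.pi * Complex.I / 5)

/-- The golden ratio `φ = (1 + √5)/2`. -/
noncomputable def goldenφ : ℝ := (1 + Real.sqrt 5) / 2

/-- `ρ(σ₁) = [[ξ⁻², 0], [0, -ξ⁻¹]]`. -/
noncomputable def rho1 : Matrix (Fin 2) (Fin 2) ℂ :=
  !![ξ ^ (-2 : ℤ), 0; 0, -ξ ^ (-1 : ℤ)]

/-- `ρ(σ₂) = [[φ⁻¹ ξ², -φ^{-1/2} ξ], [-φ^{-1/2} ξ, -φ⁻¹]]`. -/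
noncomputable def rho2 : Matrix (Fin 2) (Fin 2) ℂ :=
  !![(goldenφ : ℂ)⁻¹ * ξ ^ 2, -((Real.sqrt goldenφ⁻¹ : ℝ) : ℂ) * ξ;
     -((Real.sqrt goldenφ⁻¹ : ℝ) : ℂ) * ξ, -(goldenφ : ℂ)⁻¹]

open ComplexConjugate

noncomputable def QM (a b : ℂ) : Matrix (Fin 2) (Fin 2) ℂ := !![a, b; -conj b, conj a]

theorem QM_mul (a b c d : ℂ) : QM a b * QM c d = QM (a * c - b * conj d) (a * d + b * conj c) := by
  unfold QM
  ext i j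
  fin_cases i <;> fin_cases j <;> simp [Matrix.mul_apply, Fin.sum_univ_two] <;> ring

theorem QM_rot (K : Submonoid (Matrix (Fin 2) (Fin 2) ℂ))
    (hT : ∀ t : ℂ, ‖t‖ = 1 → QM t 0 ∈ K) {a b a' b' : ℂ} (h : QM a b ∈ K)
    (ha : ‖a'‖ = ‖a‖) (hb : ‖b'‖ = ‖b‖) : QM a' b' ∈ K := by
  have key : ∀ z z' : ℂ, ‖z'‖ = ‖z‖ → ∃ u : ℂ, ‖u‖ = 1 ∧ z' = u * z := by
    intro z z' hz
    by_cases h0 : z = 0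
    · subst h0
      exact ⟨1, by simp, by simpa using hz⟩
    · refine ⟨z' / z, ?_, by field_simp⟩
      rw [norm_div, hz, div_self (by simpa using h0)]
  obtain ⟨u, hu, rfl⟩ := key a a' ha
  obtain ⟨v, hv, rfl⟩ := key b b' hb
  obtain ⟨t, ht⟩ := IsAlgClosed.exists_pow_nat_eq (u * v) (n := 2) (by norm_num)
  have htn : ‖t‖ = 1 := by
    have h2 : ‖t‖ ^ 2 = 1 := by rw [← norm_pow, ht, norm_mul, hu, hv, one_mul]
    exact (pow_eq_one_iff_of_nonneg (norm_nonneg _) (by norm_num)).1 h2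
  have huu : u * conj u = 1 := by rw [Complex.mul_conj']; simp [hu]
  have htt : t * conj t = 1 := by rw [Complex.mul_conj']; simp [htn]
  have hsn : ‖u * conj t‖ = 1 := by simp [hu, htn]
  have := K.mul_mem (K.mul_mem (hT t htn) h) (hT _ hsn)
  rw [QM_mul, QM_mul] at this
  convert this using 2
  · simp; linear_combination (-u * a) * htt
  · simp; linear_combination (-conj u * b) * ht - v * b * huu

theorem QM_step (K : Submonoid (Matrix (Fin 2) (Fin 2) ℂ))
    (hT : ∀ t : ℂ, ‖t‖ = 1 → QM t 0 ∈ K) (c : ℝ) (hc0 : 0 < c) (hc1 : c < 1)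
    (h : ∃ a b : ℂ, ‖a‖ = c ∧ ‖a‖ ^ 2 + ‖b‖ ^ 2 = 1 ∧ QM a b ∈ K) (a b : ℂ)
    (hab : ‖a‖ ^ 2 + ‖b‖ ^ 2 = 1) (hx : |2 * c ^ 2 - 1| ≤ ‖a‖) : QM a b ∈ K := by
  obtain ⟨a₀, b₀, ha₀, h₀, hK⟩ := h
  set s := ‖b₀‖ with hs
  rw [ha₀] at h₀
  have hs0 : 0 ≤ s := norm_nonneg _
  have hcs : QM (c : ℂ) (s : ℂ) ∈ K := QM_rot K hT hK
    (by rw [ha₀]; simp [abs_of_pos hc0]) (by rw [← hs]; simp [abs_of_nonneg hs0])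
  have hx2 : (2 * c ^ 2 - 1) ^ 2 ≤ ‖a‖ ^ 2 := by
    rw [← sq_abs (2 * c ^ 2 - 1)]; gcongr
  have hd : 0 < 1 - (2 * c ^ 2 - 1) ^ 2 := by
    have : 1 - (2 * c ^ 2 - 1) ^ 2 = 4 * (c ^ 2 * ((1 - c) * (1 + c))) := by ring
    rw [this]
    have := sub_pos.2 hc1
    positivity
  have ha1 : ‖a‖ ^ 2 ≤ 1 := by nlinarith [sq_nonneg ‖b‖]
  set w := (‖a‖ ^ 2 - (2 * c ^ 2 - 1) ^ 2) / (1 - (2 * c ^ 2 - 1) ^ 2) with hw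
  have hw0 : 0 ≤ w := div_nonneg (by linarith) hd.le
  have hw1 : w ≤ 1 := by rw [hw, div_le_one hd]; linarith
  have hwe : w * (1 - (2 * c ^ 2 - 1) ^ 2) = ‖a‖ ^ 2 - (2 * c ^ 2 - 1) ^ 2 := by
    rw [hw]; field_simp
  obtain ⟨q, hq⟩ : ∃ q : ℝ, q ^ 2 = w := ⟨√w, Real.sq_sqrt hw0⟩
  obtain ⟨p, hp⟩ : ∃ p : ℝ, p ^ 2 = 1 - w := ⟨√(1 - w), Real.sq_sqrt (by linarith)⟩
  have nsq : ∀ z : ℂ, ‖z‖ ^ 2 = z.re ^ 2 + z.im ^ 2 := by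
    intro z; rw [← Complex.normSq_eq_norm_sq, Complex.normSq_apply]; ring
  have ht : ‖(⟨p, q⟩ : ℂ)‖ = 1 := by
    have := nsq ⟨p, q⟩
    simp only [] at this
    rw [hp, hq] at this
    have h2 : ‖(⟨p, q⟩ : ℂ)‖ ^ 2 = 1 := by rw [this]; ring
    exact (pow_eq_one_iff_of_nonneg (norm_nonneg _) (by norm_num)).1 h2
  have hprod := K.mul_mem (K.mul_mem hcs (hT _ ht)) hcs
  rw [QM_mul, QM_mul] at hprod
  have hc2 : c ^ 2 = 1 - s ^ 2 := by linarith
  have e1 : ∀ z w : ℂ, ‖z‖ ^ 2 = ‖w‖ ^ 2 → ‖z‖ = ‖w‖ := by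
    intro z w h
    exact (sq_eq_sq₀ (norm_nonneg _) (norm_nonneg _)).1 h
  refine QM_rot K hT hprod (e1 _ _ ?_) (e1 _ _ ?_)
  · rw [nsq (_ - _)]
    simp
    have e : (c * p * c - s * p * s) ^ 2 + (c * q * c + s * q * s) ^ 2 =
      p ^ 2 * (c ^ 2 - s ^ 2) ^ 2 + q ^ 2 * (c ^ 2 + s ^ 2) ^ 2 := by ring
    have hs2 : s ^ 2 = 1 - c ^ 2 := by linarith
    rw [e, hp, hq, hs2]
    linear_combination -hwe
  · rw [nsq (_ + _)]
    simp
    have e : (c * p * s + s * p * c) ^ 2 + (c * q * s + -(s * q * c)) ^ 2 =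
      4 * p ^ 2 * c ^ 2 * s ^ 2 := by ring
    have hs2 : s ^ 2 = 1 - c ^ 2 := by linarith
    rw [e, hp, hs2]
    linear_combination hab + hwe

theorem QM_iter (K : Submonoid (Matrix (Fin 2) (Fin 2) ℂ))
    (hT : ∀ t : ℂ, ‖t‖ = 1 → QM t 0 ∈ K) (n : ℕ) : ∀ (y : ℝ), 0 ≤ y → y < 1 →
    (∀ a b : ℂ, ‖a‖ ^ 2 + ‖b‖ ^ 2 = 1 → y ≤ ‖a‖ → QM a b ∈ K) → 1 ≤ 2 ^ n * (1 - y) →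
    ∀ a b : ℂ, ‖a‖ ^ 2 + ‖b‖ ^ 2 = 1 → QM a b ∈ K := by
  have ex : ∀ y : ℝ, 0 ≤ y → y ≤ 1 → ∃ a b : ℂ, ‖a‖ = y ∧ ‖a‖ ^ 2 + ‖b‖ ^ 2 = 1 := by
    intro y h0 h1
    refine ⟨y, √(1 - y ^ 2), by simp [abs_of_nonneg h0], ?_⟩
    have : (0:ℝ) ≤ 1 - y ^ 2 := by nlinarith
    simp [abs_of_nonneg, Real.sq_sqrt this]
  induction n with
  | zero =>
    intro y h0 h1 h hn a b hab
    refine h a b hab ?_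
    have := norm_nonneg a
    norm_num at hn
    linarith
  | succ n ih =>
    intro y h0 h1 h hn
    by_cases hy : y ^ 2 ≤ 1 / 2
    · have hr : y ≤ √(1 / 2) := Real.le_sqrt_of_sq_le hy
      have hr2 : √(1 / 2 : ℝ) ^ 2 = 1 / 2 := Real.sq_sqrt (by norm_num)
      have hr0 : 0 < √(1 / 2 : ℝ) := by positivity
      have hr1 : √(1 / 2 : ℝ) < 1 := by nlinarith
      obtain ⟨a₀, b₀, h1, h2⟩ := ex _ hr0.le hr1.le
      intro a b hab
      refine QM_step K hT _ hr0 hr1 ⟨a₀, b₀, h1, h2, h _ _ h2 (h1 ▸ hr)⟩ a b hab ?_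
      rw [hr2]; norm_num
    · push Not at hy
      have hy0 : 0 < y := by
        rcases h0.eq_or_lt with h | h
        · rw [← h] at hy; norm_num at hy
        · exact h
      obtain ⟨a₀, b₀, h3, h4⟩ := ex _ h0 h1.le
      refine ih (2 * y ^ 2 - 1) (by linarith) (by nlinarith) ?_ ?_
      · intro a b hab hx
        refine QM_step K hT _ hy0 h1 ⟨a₀, b₀, h3, h4, h _ _ h4 h3.ge⟩ a b hab ?_
        rwa [abs_of_nonneg (by linarith)]
      · rw [pow_succ] at hn
        have : (0:ℝ) < 2 ^ n := by positivity
        refine hn.trans ?_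
        rw [mul_assoc]
        refine mul_le_mul_of_nonneg_left ?_ this.le
        nlinarith

theorem norm_sq_re_im (z : ℂ) : ‖z‖ ^ 2 = z.re ^ 2 + z.im ^ 2 := by
  rw [← Complex.normSq_eq_norm_sq, Complex.normSq_apply]; ring

theorem QM_all (K : Submonoid (Matrix (Fin 2) (Fin 2) ℂ))
    (hT : ∀ t : ℂ, ‖t‖ = 1 → QM t 0 ∈ K) (a₀ b₀ : ℂ) (ha : a₀ ≠ 0) (hb : b₀ ≠ 0)
    (h₀ : ‖a₀‖ ^ 2 + ‖b₀‖ ^ 2 = 1) (hK : QM a₀ b₀ ∈ K)  :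
    ∀ a b : ℂ, ‖a‖ ^ 2 + ‖b‖ ^ 2 = 1 → QM a b ∈ K := by
  have ha' := norm_pos_iff.2 ha
  have hb' := norm_pos_iff.2 hb
  have h1 : ‖a₀‖ < 1 := by nlinarith
  have hy : |2 * ‖a₀‖ ^ 2 - 1| < 1 := by
    rw [abs_lt]; constructor <;> nlinarith
  obtain ⟨n, hn⟩ := pow_unbounded_of_one_lt (1 / (1 - |2 * ‖a₀‖ ^ 2 - 1|)) (one_lt_two)
  refine QM_iter K hT n _ (abs_nonneg _) hy ?_ ?_
  · exact fun a b hab hx => QM_step K hT _ ha' h1 ⟨a₀, b₀, rfl, h₀, hK⟩ a b hab hx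
  · rw [div_lt_iff₀ (by linarith)] at hn
    exact hn.le

theorem circle_dense (l : ℂ) (hl : ‖l‖ = 1) (hn : ∀ n : ℕ, 0 < n → l ^ n ≠ 1) (t : ℂ) (ht : ‖t‖ = 1) :
    t ∈ closure (Set.range fun n : ℤ => l ^ n) := by
  obtain ⟨θ, rfl⟩ : ∃ θ : ℝ, Complex.exp (θ * Complex.I) = l := by
    refine ⟨l.arg, ?_⟩
    have := Complex.norm_mul_exp_arg_mul_I l
    rwa [hl, Complex.ofReal_one, one_mul] at this
  obtain ⟨x, rfl⟩ : ∃ θ : ℝ, Complex.exp (θ * Complex.I) = t := by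
    refine ⟨t.arg, ?_⟩
    have := Complex.norm_mul_exp_arg_mul_I t
    rwa [ht, Complex.ofReal_one, one_mul] at this
  have hirr : Irrational (θ / (2 * Real.pi)) := by
    rintro ⟨q, hq⟩
    refine hn q.den q.pos ?_
    rw [← Complex.exp_nat_mul, Complex.exp_eq_one_iff]
    refine ⟨q.num, ?_⟩
    have hpi := Real.pi_ne_zero
    have h1 : θ = q * (2 * Real.pi) := by rw [hq]; field_simp
    have h2 : (q.den : ℝ) * q = q.num := by
      exact_mod_cast Rat.den_mul_eq_num q
    have h3 : (q.den : ℝ) * θ = q.num * (2 * Real.pi) := by rw [h1, ← h2]; ring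
    have h4 : (q.den : ℂ) * θ = q.num * (2 * Real.pi) := by exact_mod_cast h3
    rw [← mul_assoc, h4]; ring
  have hd := dense_addSubgroupClosure_pair_iff.2 hirr
  have hc : Continuous fun y : ℝ => Complex.exp (y * Complex.I) := by fun_prop
  have := image_closure_subset_closure_image hc (Set.mem_image_of_mem _ (hd x))
  refine closure_mono ?_ this
  rintro _ ⟨y, hy, rfl⟩
  rw [SetLike.mem_coe, AddSubgroup.mem_closure_pair] at hy
  obtain ⟨m, k, rfl⟩ := hy
  refine ⟨m, ?_⟩
  simp only
  rw [← Complex.exp_int_mul, Complex.exp_eq_exp_iff_exists_int]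
  refine ⟨-k, ?_⟩
  push_cast
  simp
  ring

theorem infinite_order (l : ℂ) (hl : ‖l‖ = 1) (hre : 2 * l.re = (3 - √5) / 2) (n : ℕ) (hn0 : 0 < n) :
    l ^ n ≠ 1 := by
  have h5 : √5 ^ 2 = (5:ℝ) := Real.sq_sqrt (by norm_num)
  have h5' : (2:ℝ) < √5 := by
    rw [Real.lt_sqrt] <;> norm_num
  have hrec : ∀ n, 2 * (l ^ (n + 2)).re = (3 - √5) / 2 * (2 * (l ^ (n + 1)).re) - 2 * (l ^ n).re := by
    intro n
    have h2 : l ^ 2 = 2 * l.re * l - 1 := by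
      have := norm_sq_re_im l
      rw [hl] at this
      apply Complex.ext
      · simp [pow_two]; linarith
      · simp [pow_two]; ring
    have : l ^ (n + 2) = (2 * l.re : ℝ) * l ^ (n + 1) - l ^ n := by
      rw [pow_add, h2, pow_succ]; push_cast; ring
    rw [this, Complex.sub_re, Complex.re_ofReal_mul, hre]; ring
  have main : ∀ n, ∃ a b c d : ℤ, 2 * (l ^ n).re = a + b * ((3 - √5) / 2) ∧
      2 * (l ^ (n + 1)).re = c + d * ((3 - √5) / 2) ∧ 2 ≤ a + b * ((3 + √5) / 2) ∧
      a + b * ((3 + √5) / 2) < c + d * ((3 + √5) / 2) := by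
    intro n
    induction n with
    | zero => refine ⟨2, 0, 0, 1, by simp, by simp [hre], by simp, by simp; linarith⟩
    | succ n ih =>
      obtain ⟨a, b, c, d, h1, h2, h3, h4⟩ := ih
      refine ⟨c, d, -d - a, c + 3 * d - b, h2, ?_, by linarith, ?_⟩
      · rw [hrec, h1, h2]; push_cast
        linear_combination (d / 4 : ℝ) * h5
      · push_cast
        have e : (-d - a + (c + 3 * d - b) * ((3 + √5) / 2) : ℝ) =
            (3 + √5) / 2 * (c + d * ((3 + √5) / 2)) - (a + b * ((3 + √5) / 2)) := by
          linear_combination (-d / 4 : ℝ) * h5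
        rw [e]
        nlinarith
  intro h
  obtain ⟨m, rfl⟩ : ∃ m, n = m + 1 := ⟨n - 1, by omega⟩
  obtain ⟨a, b, c, d, h1, h2, h3, h4⟩ := main m
  rw [h] at h2
  simp only [Complex.one_re] at h2
  have hirr : Irrational (√5) := by
    simpa using (Nat.Prime.irrational_sqrt (p := 5) (by norm_num))
  have hd : (d : ℝ) ≠ 0 := by
    intro hd
    rw [hd] at h2 h4
    linarith
  refine hirr ⟨(2 * c + 3 * d - 4) / d, ?_⟩
  push_cast
  rw [div_eq_iff hd]
  linarith

theorem QM_inj {a b c d : ℂ} (h : QM a b = QM c d) : a = c ∧ b = d := by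
  have h1 := congrFun (congrFun h 0) 0
  have h2 := congrFun (congrFun h 0) 1
  simpa [QM] using And.intro h1 h2

theorem QM_one : QM 1 0 = 1 := by
  ext i j
  fin_cases i <;> fin_cases j <;> simp [QM]

theorem QM_of_SU (U : Matrix (Fin 2) (Fin 2) ℂ) (hU : U ∈ Matrix.specialUnitaryGroup (Fin 2) ℂ) :
    ∃ a b : ℂ, ‖a‖ ^ 2 + ‖b‖ ^ 2 = 1 ∧ U = QM a b := by
  obtain ⟨h1, h2⟩ := Matrix.mem_specialUnitaryGroup_iff.1 hU
  have h3 := Matrix.mem_unitaryGroup_iff.1 h1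
  have h4 : star U = U.adjugate := by
    have : U.adjugate * U = 1 := by rw [Matrix.adjugate_mul, h2, one_smul]
    calc star U = U.adjugate * U * star U := by rw [this, one_mul]
      _ = U.adjugate := by rw [mul_assoc, h3, mul_one]
  rw [Matrix.adjugate_fin_two] at h4
  have e1 := congrFun (congrFun h4 0) 0
  have e2 := congrFun (congrFun h4 0) 1
  have e3 := congrFun (congrFun h4 1) 0
  simp [Matrix.star_apply] at e1 e2 e3
  refine ⟨U 0 0, U 0 1, ?_, ?_⟩
  · rw [Matrix.det_fin_two] at h2
    have : ((‖U 0 0‖ ^ 2 + ‖U 0 1‖ ^ 2 : ℝ) : ℂ) = 1 := by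
      push_cast
      rw [← Complex.mul_conj', ← Complex.mul_conj', ← h2, e1, e3]; ring
    exact_mod_cast this
  · ext i j
    fin_cases i <;> fin_cases j <;> simp [QM, e1, e3]

theorem QM_norm_mul {a b c d : ℂ} (h1 : ‖a‖ ^ 2 + ‖b‖ ^ 2 = 1) (h2 : ‖c‖ ^ 2 + ‖d‖ ^ 2 = 1) :
    ‖a * c - b * conj d‖ ^ 2 + ‖a * d + b * conj c‖ ^ 2 = 1 := by
  have : ‖a * c - b * conj d‖ ^ 2 + ‖a * d + b * conj c‖ ^ 2 =
      (‖a‖ ^ 2 + ‖b‖ ^ 2) * (‖c‖ ^ 2 + ‖d‖ ^ 2) := by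
    simp only [norm_sq_re_im]; simp; ring
  rw [this, h1, h2, one_mul]

theorem SU2_of_pair (K : Submonoid (Matrix (Fin 2) (Fin 2) ℂ))
    (hcl : IsClosed (K : Set (Matrix (Fin 2) (Fin 2) ℂ))) (α β γ δ : ℂ)
    (h1 : ‖α‖ ^ 2 + ‖β‖ ^ 2 = 1) (h2 : ‖γ‖ ^ 2 + ‖δ‖ ^ 2 = 1) (hβ : β ≠ 0)
    (hre : 2 * α.re = (3 - √5) / 2) (hγ : γ.re ≠ 0)
    (hg : QM α β ∈ K) (hg' : QM (conj α) (-β) ∈ K) (hh : QM γ δ ∈ K)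
    (hne : QM α β * QM γ δ ≠ QM γ δ * QM α β) (a b : ℂ) (hab : ‖a‖ ^ 2 + ‖b‖ ^ 2 = 1) :
    QM a b ∈ K := by
  have hr : α.re ^ 2 ≤ 1 := by
    rw [norm_sq_re_im] at h1; nlinarith [sq_nonneg ‖β‖, sq_nonneg α.im]
  set l : ℂ := ⟨α.re, √(1 - α.re ^ 2)⟩ with hldef
  have hl : ‖l‖ ^ 2 = 1 := by
    rw [norm_sq_re_im, hldef]; simp only
    rw [Real.sq_sqrt (by linarith)]; ring
  have hl1 : ‖l‖ = 1 := (pow_eq_one_iff_of_nonneg (norm_nonneg _) (by norm_num)).1 hl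
  have hll : l * conj l = 1 := by rw [Complex.mul_conj']; simp [hl1]
  have hlre : l + conj l = α + conj α := by
    rw [Complex.add_conj, Complex.add_conj]
  have hab1 : α * conj α + β * conj β = 1 := by
    rw [Complex.mul_conj', Complex.mul_conj']; exact_mod_cast h1
  -- eigenvector
  set N : ℝ := √(‖β‖ ^ 2 + ‖l - α‖ ^ 2) with hN
  have hβ' := norm_pos_iff.2 hβ
  have hN2 : N ^ 2 = ‖β‖ ^ 2 + ‖l - α‖ ^ 2 := Real.sq_sqrt (by positivity)
  have hN0 : 0 < N := Real.sqrt_pos.2 (by positivity)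
  set p : ℂ := β / N with hp
  set q : ℂ := (l - α) / N with hq
  have hpq : ‖p‖ ^ 2 + ‖q‖ ^ 2 = 1 := by
    rw [hp, hq, norm_div, norm_div, div_pow, div_pow]
    simp only [Complex.norm_real, Real.norm_eq_abs, sq_abs]
    rw [hN2]; field_simp
  have hpqc : p * conj p + q * conj q = 1 := by
    rw [Complex.mul_conj', Complex.mul_conj']; exact_mod_cast hpq
  set V := QM p (-conj q) with hV
  set W := QM (conj p) (conj q) with hW
  have hVW : V * W = 1 := by
    rw [hV, hW, QM_mul, ← QM_one]; congr 1
    · simp; linear_combination hpqc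
    · simp; ring
  have hWV : W * V = 1 := by
    rw [hV, hW, QM_mul, ← QM_one]; congr 1
    · simp; linear_combination hpqc
    · simp; ring
  have hN0c : (N : ℂ) ≠ 0 := by exact_mod_cast hN0.ne'
  have hgV : QM α β * V = V * QM l 0 := by
    have hNp : N * p = β := by rw [hp]; field_simp
    have hNq : N * q = l - α := by rw [hq]; field_simp
    have hNq' : N * conj q = conj l - conj α := by
      have := congrArg conj hNq; simpa using this
    have hNp' : N * conj p = conj β := by
      have := congrArg conj hNp; simpa using this
    rw [hV, QM_mul, QM_mul]; congr 1
    · simp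
      apply mul_left_cancel₀ hN0c
      linear_combination (α - l) * hNp + β * hNq
    · simp
      apply mul_left_cancel₀ hN0c
      linear_combination (conj l - α) * hNq' + β * hNp' + hab1 - hll + conj l * hlre
  let c : Matrix (Fin 2) (Fin 2) ℂ →* Matrix (Fin 2) (Fin 2) ℂ :=
    { toFun := fun X => V * X * W
      map_one' := by rw [mul_one, hVW]
      map_mul' := by
        intro X Y
        calc V * (X * Y) * W = V * X * 1 * Y * W := by simp only [mul_assoc, one_mul]
          _ = _ := by rw [← hWV]; simp only [mul_assoc] }
  have hcapp : ∀ X, c X = V * X * W := fun _ => rfl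
  have hccont : Continuous c := by
    change Continuous fun X => V * X * W
    fun_prop
  set K' := K.comap c with hK'
  have hK'cl : IsClosed (K' : Set (Matrix (Fin 2) (Fin 2) ℂ)) := hcl.preimage hccont
  have back : ∀ X, X ∈ K → W * X * V ∈ K' := by
    intro X hX
    rw [hK', Submonoid.mem_comap, hcapp]
    have : V * (W * X * V) * W = X := by
      calc V * (W * X * V) * W = (V * W) * X * (V * W) := by simp only [mul_assoc]
        _ = X := by rw [hVW]; simp
    rwa [this]
  have hl_eq : W * QM α β * V = QM l 0 := by
    rw [mul_assoc, hgV, ← mul_assoc, hWV, one_mul]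
  have hgg' : QM (conj α) (-β) * QM α β = 1 := by
    rw [QM_mul, ← QM_one]; congr 1
    · linear_combination hab1
    · simp; ring
  have hll' : QM l 0 * QM (conj l) 0 = 1 := by
    rw [QM_mul, ← QM_one]; congr 1
    · simp [hll]
    · simp
  have hl'_eq : W * QM (conj α) (-β) * V = QM (conj l) 0 := by
    calc W * QM (conj α) (-β) * V = W * QM (conj α) (-β) * V * (QM l 0 * QM (conj l) 0) := by
          rw [hll', mul_one]
      _ = W * (QM (conj α) (-β) * (V * QM l 0)) * QM (conj l) 0 := by simp only [mul_assoc]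
      _ = W * ((QM (conj α) (-β) * QM α β) * V) * QM (conj l) 0 := by
          rw [← hgV]; simp only [mul_assoc]
      _ = _ := by rw [hgg', one_mul, hWV, one_mul]
  have hKl : QM l 0 ∈ K' := hl_eq ▸ back _ hg
  have hKl' : QM (conj l) 0 ∈ K' := hl'_eq ▸ back _ hg'
  have dpow : ∀ (z : ℂ) (n : ℕ), QM z 0 ∈ K' → QM (z ^ n) 0 ∈ K' := by
    intro z n hz
    induction n with
    | zero => rw [pow_zero, QM_one]; exact K'.one_mem
    | succ n ih =>
      have := K'.mul_mem ih hz
      rw [QM_mul] at this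
      simpa [pow_succ] using this
  have hlinv : l⁻¹ = conj l := by
    exact inv_eq_of_mul_eq_one_right hll
  have hzpow : ∀ n : ℤ, QM (l ^ n) 0 ∈ K' := by
    intro n
    rcases Int.eq_nat_or_neg n with ⟨m, rfl | rfl⟩
    · rw [zpow_natCast]; exact dpow _ _ hKl
    · rw [_root_.zpow_neg, zpow_natCast, ← inv_pow, hlinv]; exact dpow _ _ hKl'
  have hT : ∀ t : ℂ, ‖t‖ = 1 → QM t 0 ∈ K' := by
    intro t ht
    have hmem := circle_dense l hl1 (infinite_order l hl1 hre) t ht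
    have hc : Continuous fun z : ℂ => QM z 0 := by
      refine continuous_matrix ?_
      intro i j
      fin_cases i <;> fin_cases j <;> simp [QM] <;> fun_prop
    have hclosed : IsClosed {z : ℂ | QM z 0 ∈ K'} := hK'cl.preimage hc
    refine closure_minimal ?_ hclosed hmem
    rintro _ ⟨n, rfl⟩
    exact hzpow n
  -- the second element
  have hqW : ‖(-conj q)‖ = ‖q‖ := by simp
  have hV1 : ‖p‖ ^ 2 + ‖-conj q‖ ^ 2 = 1 := by rw [hqW]; exact hpq
  have hW1 : ‖conj p‖ ^ 2 + ‖conj q‖ ^ 2 = 1 := by simpa using hpq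
  obtain ⟨a₀, b₀, h₀, hab₀⟩ : ∃ a₀ b₀, ‖a₀‖ ^ 2 + ‖b₀‖ ^ 2 = 1 ∧ W * QM γ δ * V = QM a₀ b₀ := by
    rw [hW, hV, QM_mul, QM_mul]
    exact ⟨_, _, QM_norm_mul (QM_norm_mul hW1 h2) hV1, rfl⟩
  have hhV : QM γ δ = V * QM a₀ b₀ * W := by
    rw [← hab₀]
    calc QM γ δ = (V * W) * QM γ δ * (V * W) := by rw [hVW]; simp
      _ = _ := by simp only [mul_assoc]
  have hgV2 : QM α β = V * QM l 0 * W := by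
    rw [← hgV, mul_assoc, hVW, mul_one]
  have hb₀ : b₀ ≠ 0 := by
    intro hb
    apply hne
    rw [hhV, hgV2, hb]
    have e : ∀ X Y, (V * X * W) * (V * Y * W) = V * (X * Y) * W := by
      intro X Y
      calc (V * X * W) * (V * Y * W) = V * X * (W * V) * Y * W := by simp only [mul_assoc]
        _ = _ := by rw [hWV]; simp only [mul_assoc, one_mul]
    rw [e, e, QM_mul l, QM_mul a₀]
    simp [mul_comm a₀ l]
  have htr : ∀ x y, (QM x y).trace = 2 * x.re := by
    intro x y
    simp [QM, Matrix.trace_fin_two, Complex.add_conj]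
  have ha₀ : a₀ ≠ 0 := by
    intro ha
    apply hγ
    have t1 := htr γ δ
    rw [hhV, Matrix.trace_mul_comm, ← mul_assoc, hWV, one_mul, htr, ha] at t1
    simpa using t1.symm
  have hall := QM_all K' hT a₀ b₀ ha₀ hb₀ h₀ (hab₀ ▸ back _ hh)
  have hfin : W * QM a b * V ∈ K' := by
    rw [hW, hV, QM_mul, QM_mul]
    exact hall _ _ (QM_norm_mul (QM_norm_mul hW1 hab) hV1)
  rw [hK', Submonoid.mem_comap, hcapp] at hfin
  have : V * (W * QM a b * V) * W = QM a b := by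
    calc V * (W * QM a b * V) * W = (V * W) * QM a b * (V * W) := by simp only [mul_assoc]
      _ = QM a b := by rw [hVW]; simp
  rwa [this] at hfin

theorem xi_pow : ξ ^ 5 = 1 := by
  rw [ξ, ← Complex.exp_nat_mul, Complex.exp_eq_one_iff]
  exact ⟨1, by push_cast; ring⟩

theorem xi_norm : ‖ξ‖ = 1 := by
  have : ‖ξ‖ ^ 5 = 1 := by rw [← norm_pow, xi_pow, norm_one]
  exact (pow_eq_one_iff_of_nonneg (norm_nonneg _) (by norm_num)).1 this

theorem xi_ne : ξ ≠ 0 := by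
  intro h; have := xi_norm; simp [h] at this

theorem xi_conj : conj ξ = ξ ^ 4 := by
  have h : ξ * conj ξ = 1 := by rw [Complex.mul_conj']; simp [xi_norm]
  apply mul_left_cancel₀ xi_ne
  rw [h, ← xi_pow]; ring

theorem xi_re : ξ.re = (√5 - 1) / 4 := by
  have h5 : √5 ^ 2 = (5:ℝ) := Real.sq_sqrt (by norm_num)
  have : (2 * Real.pi * Complex.I / 5 : ℂ) = ((2 * (Real.pi / 5) : ℝ) : ℂ) * Complex.I := by
    push_cast; ring
  rw [ξ, this, Complex.exp_ofReal_mul_I_re, Real.cos_two_mul, Real.cos_pi_div_five]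
  linear_combination (1 / 8 : ℝ) * h5

theorem phi_inv : goldenφ⁻¹ = (√5 - 1) / 2 := by
  have h5 : √5 ^ 2 = (5:ℝ) := Real.sq_sqrt (by norm_num)
  apply inv_eq_of_mul_eq_one_right
  rw [goldenφ]
  linear_combination (1 / 4 : ℝ) * h5

/-- The topological closure of the group generated by `ρ(σ₁)` and `ρ(σ₂)` (i.e. of
the monoid generated by `ρ(σ₁)^{±1}` and `ρ(σ₂)^{±1}`) contains `SU(2)`: every
`2 × 2` unitary matrix of determinant `1` is a limit of products of
`ρ(σ₁)^{±1}` and `ρ(σ₂)^{±1}`. -/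
theorem fibonacci_rep_dense_in_SU2 :
    ∀ U ∈ Matrix.specialUnitaryGroup (Fin 2) ℂ,
      U ∈ closure ((Submonoid.closure {rho1, rho2, rho1⁻¹, rho2⁻¹} :
        Submonoid (Matrix (Fin 2) (Fin 2) ℂ)) : Set (Matrix (Fin 2) (Fin 2) ℂ)) := by
  intro U hU
  obtain ⟨a, b, hab, rfl⟩ := QM_of_SU U hU
  have h5 : √5 ^ 2 = (5:ℝ) := Real.sq_sqrt (by norm_num)
  have h5' : (2:ℝ) < √5 := by
    rw [Real.lt_sqrt] <;> norm_num
  have hx5 := xi_pow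
  have hx0 := xi_ne
  have hxc := xi_conj
  have hm1 : ξ ^ (-1 : ℤ) = ξ ^ 4 := by
    rw [_root_.zpow_neg_one]; exact inv_eq_of_mul_eq_one_right (by rw [← hx5]; ring)
  have hm2 : ξ ^ (-2 : ℤ) = ξ ^ 3 := by
    rw [_root_.zpow_neg]; exact inv_eq_of_mul_eq_one_right (by rw [← hx5]; norm_cast; ring)
  set f : ℝ := goldenφ⁻¹ with hf
  have hfv : f = (√5 - 1) / 2 := phi_inv
  have hf0 : 0 < f := by linarith
  set s : ℝ := √f with hs
  have hs0 : 0 < s := Real.sqrt_pos.2 hf0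
  have hs2 : s ^ 2 = f := Real.sq_sqrt hf0.le
  have hff : f ^ 2 + f = 1 := by rw [hfv]; linear_combination (1 / 4 : ℝ) * h5
  have hs2c : (s : ℂ) ^ 2 = f := by exact_mod_cast hs2
  have hffc : (f : ℂ) ^ 2 + f = 1 := by exact_mod_cast hff
  have hfc : (goldenφ : ℂ)⁻¹ = f := by rw [hf]; push_cast; rfl
  have r1 : rho1 = !![ξ ^ 3, 0; 0, -ξ ^ 4] := by rw [rho1, hm1, hm2]
  have r2 : rho2 = !![f * ξ ^ 2, -s * ξ; -s * ξ, -f] := by rw [rho2, hfc]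
  have r1i : rho1⁻¹ = !![ξ ^ 2, 0; 0, -ξ] := by
    apply Matrix.inv_eq_right_inv
    rw [r1]
    ext i j
    fin_cases i <;> fin_cases j <;> simp [Matrix.mul_apply, Fin.sum_univ_two] <;>
      linear_combination hx5
  have r2i : rho2⁻¹ = !![f * ξ ^ 3, -s * ξ ^ 4; -s * ξ ^ 4, -f] := by
    apply Matrix.inv_eq_right_inv
    rw [r2]
    ext i j
    fin_cases i <;> fin_cases j <;> simp [Matrix.mul_apply, Fin.sum_univ_two]
    · linear_combination (f ^ 2 + s ^ 2 : ℂ) * hx5 + hs2c + hffc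
    · linear_combination (-f * s * ξ : ℂ) * hx5
    · ring
    · linear_combination (s ^ 2 : ℂ) * hx5 + hs2c + hffc
  set G := Submonoid.closure {rho1, rho2, rho1⁻¹, rho2⁻¹} with hG
  have m1 : rho1 ∈ G := Submonoid.subset_closure (by simp)
  have m2 : rho2 ∈ G := Submonoid.subset_closure (by simp)
  have m1i : rho1⁻¹ ∈ G := Submonoid.subset_closure (by simp)
  have m2i : rho2⁻¹ ∈ G := Submonoid.subset_closure (by simp)
  have eg : rho1 * rho2⁻¹ = QM (f * ξ) (-s * ξ ^ 2) := by
    rw [r1, r2i, QM]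
    ext i j
    fin_cases i <;> fin_cases j <;> simp [Matrix.mul_apply, Fin.sum_univ_two, hxc]
    · linear_combination (f * ξ : ℂ) * hx5
    · linear_combination (s * ξ ^ 2 : ℂ) * hx5
    · ring
    · ring
  have eg' : rho2 * rho1⁻¹ = QM (conj (f * ξ)) (-(-s * ξ ^ 2)) := by
    rw [r1i, r2, QM]
    ext i j
    fin_cases i <;> fin_cases j <;> simp [Matrix.mul_apply, Fin.sum_univ_two, hxc]
    · ring
    · ring
    · linear_combination (-s * ξ ^ 3 : ℂ) * hx5
    · left
      linear_combination (-ξ * (ξ ^ 10 + ξ ^ 5 + 1) : ℂ) * hx5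
  have eh : rho2⁻¹ * rho1 = QM (f * ξ) (s * ξ ^ 3) := by
    rw [r1, r2i, QM]
    ext i j
    fin_cases i <;> fin_cases j <;> simp [Matrix.mul_apply, Fin.sum_univ_two, hxc]
    · linear_combination (f * ξ : ℂ) * hx5
    · linear_combination (s * ξ ^ 3 : ℂ) * hx5
    · linear_combination (-s * ξ ^ 7 : ℂ) * hx5
  have hfre : ((f : ℂ) * ξ).re = (3 - √5) / 4 := by
    rw [Complex.re_ofReal_mul, xi_re, hfv]; linear_combination (1 / 8 : ℝ) * h5
  have hsc : (s : ℂ) ≠ 0 := by exact_mod_cast hs0.ne'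
  have hfc0 : (f : ℂ) ≠ 0 := by exact_mod_cast hf0.ne'
  have sub : ∀ X ∈ G, X ∈ G.topologicalClosure := fun X hX => G.le_topologicalClosure hX
  have n1 : ‖(f : ℂ) * ξ‖ ^ 2 = f ^ 2 := by simp [xi_norm]
  refine SU2_of_pair G.topologicalClosure G.isClosed_topologicalClosure
    (f * ξ) (-s * ξ ^ 2) (f * ξ) (s * ξ ^ 3) ?_ ?_ ?_ ?_ ?_ (sub _ (eg ▸ G.mul_mem m1 m2i))
    (sub _ (eg' ▸ G.mul_mem m2 m1i)) (sub _ (eh ▸ G.mul_mem m2i m1)) ?_ a b hab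
  · rw [n1]; simp [xi_norm]; linarith
  · rw [n1]; simp [xi_norm]; linarith
  · simp [hsc, hx0]
  · rw [hfre]; ring
  · rw [hfre]; 
    have : √5 < 3 := by nlinarith
    intro h; linarith
  · intro h
    rw [QM_mul, QM_mul] at h
    have h' := (QM_inj h).2
    simp [hxc] at h'
    have h3 : (f * s : ℂ) * (ξ * ((ξ - 1) * (ξ + 1) ^ 2)) = 0 := by
      linear_combination h' + (f * s * (ξ + ξ ^ 2) : ℂ) * hx5
    have h4 := xi_re
    rcases mul_eq_zero.1 h3 with h | h
    · exact (mul_ne_zero hfc0 hsc) h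
    rcases mul_eq_zero.1 h with h | h
    · exact hx0 h
    rcases mul_eq_zero.1 h with h | h
    · rw [sub_eq_zero.1 h, Complex.one_re] at h4
      nlinarith
    · rw [eq_neg_of_add_eq_zero_left (pow_eq_zero_iff (by norm_num) |>.1 h)] at h4
      simp at h4
      nlinarith
end

section
/- Let H = (1/√2)·[[1, 1], [1, −1]] (the Hadamard gate) and T = [[1, 0], [0, e^{iπ/4}]] (the π/8 phase gate), both of which are 2×2 unitary matrices. Then the topological closure (in the space of 2×2 complex matrices) of the subgroup of the unitary group U(2) generated by H and T contains the special unitary group SU(2): every 2×2 unitary matrix of determinant 1 is a limit of finite products of H, T and their inverses. -/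
open Matrix

/-- The Hadamard gate `H = (1/√2)·[[1, 1], [1, -1]]`. -/
noncomputable def Hgate : Matrix (Fin 2) (Fin 2) ℂ :=
  (((Real.sqrt 2 : ℝ) : ℂ))⁻¹ • !![1, 1; 1, -1]

/-- The `π/8` phase gate `T = [[1, 0], [0, e^{iπ/4}]]`. -/
noncomputable def Tgate : Matrix (Fin 2) (Fin 2) ℂ :=
  !![1, 0; 0, Complex.exp (Real.pi * Complex.I / 4)]

noncomputable def rr : ℂ := ((Real.sqrt 2 : ℝ) : ℂ)

noncomputable def pp : ℝ := (Real.sqrt (10 - 4 * Real.sqrt 2))⁻¹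

noncomputable def FF (c s : ℝ) : Matrix (Fin 2) (Fin 2) ℂ :=
  !![c - Complex.I * rr * pp * s, (2 - rr + Complex.I * rr) * pp * s;
     (-2 + rr + Complex.I * rr) * pp * s, c + Complex.I * rr * pp * s]

noncomputable def DD (u v : ℂ) : Matrix (Fin 2) (Fin 2) ℂ := !![u, 0; 0, v]

lemma rr_sq : rr ^ 2 = 2 := by
  unfold rr
  norm_cast
  exact Real.sq_sqrt (by norm_num)

lemma rr_ne : rr ≠ 0 := by
  intro h
  have := rr_sq
  rw [h] at this
  norm_num at this

lemma sqrt2_lt : Real.sqrt 2 < 3 / 2 := by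
  rw [Real.sqrt_lt' (by norm_num)]; norm_num

lemma pp_sq : pp ^ 2 * (10 - 4 * Real.sqrt 2) = 1 := by
  have h : 0 < 10 - 4 * Real.sqrt 2 := by linarith [sqrt2_lt]
  unfold pp
  rw [inv_pow, Real.sq_sqrt h.le]
  exact inv_mul_cancel₀ h.ne'

lemma pp_sqC : (pp : ℂ) ^ 2 * (10 - 4 * rr) = 1 := by
  unfold rr
  exact_mod_cast pp_sq

lemma omega_eq : Complex.exp (Real.pi * Complex.I / 4) = rr / 2 * (1 + Complex.I) := by
  have : (Real.pi * Complex.I / 4 : ℂ) = ((Real.pi / 4 : ℝ) : ℂ) * Complex.I := by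
    push_cast; ring
  rw [this, Complex.exp_mul_I, ← Complex.ofReal_cos, ← Complex.ofReal_sin, Real.cos_pi_div_four,
    Real.sin_pi_div_four]
  unfold rr
  push_cast; ring

lemma T_eq : Tgate = !![1, 0; 0, rr / 2 * (1 + Complex.I)] := by
  unfold Tgate; rw [omega_eq]

lemma H_eq : Hgate = (rr / 2) • !![1, 1; 1, -1] := by
  unfold Hgate
  congr 1
  have := rr_sq
  have h := rr_ne
  change rr⁻¹ = _
  field_simp
  linear_combination -this

lemma H_sq : Hgate * Hgate = 1 := by
  rw [H_eq]
  have := rr_sq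
  ext i j
  fin_cases i <;> fin_cases j <;> simp [Matrix.mul_apply, Fin.sum_univ_two] <;>
    linear_combination (1/2) * this

lemma H_inv : Hgate⁻¹ = Hgate := Matrix.inv_eq_right_inv H_sq

lemma T_inv : Tgate⁻¹ = !![1, 0; 0, rr / 2 * (1 - Complex.I)] := by
  apply Matrix.inv_eq_right_inv
  rw [T_eq]
  have := rr_sq
  have h2 := Complex.I_sq
  ext i j
  fin_cases i <;> fin_cases j <;> simp [Matrix.mul_apply, Fin.sum_univ_two]
  linear_combination (1/2) * this - rr^2/4 * h2

lemma T4 : Tgate * Tgate * (Tgate * Tgate) = DD 1 (-1) := by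
  rw [T_eq]
  have := rr_sq
  have h2 := Complex.I_sq
  unfold DD
  ext i j
  fin_cases i <;> fin_cases j <;> simp [Matrix.mul_apply, Fin.sum_univ_two]
  have h3 : rr ^ 4 = 4 := by linear_combination (rr^2+2) * this
  have h4 : (1 + Complex.I)^4 = -4 := by linear_combination (Complex.I^2+4*Complex.I+5) * h2
  linear_combination (1+Complex.I)^4/16*h3 + h4/4

lemma FF_mul (c s c' s' : ℝ) : FF c s * FF c' s' = FF (c * c' - s * s') (s * c' + c * s') := by
  have h1 := rr_sq
  have h2 := Complex.I_sq
  have h3 := pp_sqC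
  unfold FF
  ext i j
  fin_cases i <;> fin_cases j <;> simp [Matrix.mul_apply, Fin.sum_univ_two] <;>
    grind

lemma FF_det (c s : ℝ) : (FF c s).det = c ^ 2 + s ^ 2 := by
  have h1 := rr_sq
  have h2 := Complex.I_sq
  have h3 := pp_sqC
  unfold FF
  rw [Matrix.det_fin_two]
  simp
  grind

noncomputable def dd : ℝ := (6 - 4 * Real.sqrt 2) * pp ^ 2

lemma dd_C : (dd : ℂ) = (6 - 4 * rr) * pp ^ 2 := by
  unfold dd rr; push_cast; ring

lemma dd_lt : 0 ≤ dd ∧ 2 * dd < 1 := by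
  have h := pp_sq
  have h1 := sqrt2_lt
  have h2 : 0 < pp ^ 2 := by
    unfold pp
    have : 0 < 10 - 4 * Real.sqrt 2 := by linarith [sqrt2_lt]
    positivity
  have h3 : 1 < Real.sqrt 2 := by
    rw [Real.lt_sqrt (by norm_num)]; norm_num
  unfold dd
  constructor <;> nlinarith

lemma key (C S c s : ℝ) (h : C ^ 2 + S ^ 2 = 1)
    (hc : 2 * S * C * c + (1 - 2 * dd * S ^ 2) * s = 0) :
    FF C S * (DD 1 (-1) * FF c (-s) * DD 1 (-1)) * FF C S =
      DD (((C ^ 2 - S ^ 2) * c - 2 * dd * S * C * s : ℝ) + (2 * Real.sqrt 2 * pp * s : ℝ) * Complex.I)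
      (((C ^ 2 - S ^ 2) * c - 2 * dd * S * C * s : ℝ) - (2 * Real.sqrt 2 * pp * s : ℝ) * Complex.I) := by
  have h1 := rr_sq
  have h2 := Complex.I_sq
  have h3 := pp_sqC
  have h4 := dd_C
  have h5 : (C : ℂ) ^ 2 + S ^ 2 = 1 := by exact_mod_cast h
  have h6 : 2 * S * C * c + (1 - 2 * dd * S ^ 2) * s = (0 : ℂ) := by exact_mod_cast hc
  have h7 : ((Real.sqrt 2 : ℝ) : ℂ) = rr := rfl
  unfold FF DD
  ext i j
  fin_cases i <;> fin_cases j <;> simp [Matrix.mul_apply, Fin.sum_univ_two, h7] <;>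
    grind

lemma irr : Irrational (Real.arccos ((2 + Real.sqrt 2) / 4) / (2 * Real.pi)) := by
  rintro ⟨q, hq⟩
  have hpi := Real.pi_pos.ne'
  have h1 : Real.arccos ((2 + Real.sqrt 2) / 4) = ((2 * q : ℚ) : ℝ) * Real.pi := by
    push_cast
    rw [hq]
    field_simp
  have h2 := Real.isIntegral_two_mul_cos_rat_mul_pi (2 * q)
  rw [← h1, Real.cos_arccos (by linarith [Real.sqrt_nonneg 2]) (by linarith [sqrt2_lt])] at h2
  have h3 : IsIntegral ℤ ((2 * ((2 + Real.sqrt 2) / 4) - 1) ^ 2) := (h2.sub isIntegral_one).pow 2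
  have h4 : ((2 * ((2 + Real.sqrt 2) / 4) - 1) ^ 2 : ℝ) = algebraMap ℚ ℝ (1 / 2) := by
    have : Real.sqrt 2 ^ 2 = 2 := Real.sq_sqrt (by norm_num)
    simp
    linear_combination this / 4
  rw [h4, isIntegral_algebraMap_iff (algebraMap ℚ ℝ).injective,
    IsIntegrallyClosed.isIntegral_iff] at h3
  obtain ⟨n, hn⟩ := h3
  have h5 : (n : ℚ) * 2 = 1 := by
    have : (n : ℚ) = 1 / 2 := hn
    rw [this]; norm_num
  have h6 : n * 2 = 1 := by exact_mod_cast h5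
  omega

lemma A_eq : Tgate * Hgate * Tgate⁻¹ * Hgate =
    FF ((2 + Real.sqrt 2) / 4) (Real.sqrt (10 - 4 * Real.sqrt 2) / 4) := by
  have h1 := rr_sq
  have h2 := Complex.I_sq
  have h : 0 < 10 - 4 * Real.sqrt 2 := by linarith [sqrt2_lt]
  have h3 : (pp : ℂ) * (Real.sqrt (10 - 4 * Real.sqrt 2) / 4 : ℝ) = 1 / 4 := by
    have : pp * (Real.sqrt (10 - 4 * Real.sqrt 2) / 4) = 1 / 4 := by
      unfold pp
      have := (Real.sqrt_pos.2 h).ne'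
      field_simp
    rw [← Complex.ofReal_mul, this]; norm_num
  have h7 : ((Real.sqrt 2 : ℝ) : ℂ) = rr := rfl
  unfold FF
  simp only [mul_assoc, h3]
  rw [T_inv, H_eq, T_eq]
  ext i j
  fin_cases i <;> fin_cases j <;> simp [Matrix.mul_apply, Fin.sum_univ_two, h7] <;>
    grind

lemma H_conj (c s : ℝ) : Hgate * FF c s * Hgate = FF c (-s) := by
  rw [H_eq]
  have h1 := rr_sq
  unfold FF
  ext i j
  fin_cases i <;> fin_cases j <;> simp [Matrix.mul_apply, Fin.sum_univ_two] <;>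
    grind

lemma angle (c s : ℝ) (h : c ^ 2 + s ^ 2 = 1) : ∃ t : ℝ, Real.cos t = c ∧ Real.sin t = s := by
  have hn : ‖(⟨c, s⟩ : ℂ)‖ = 1 := by
    rw [← sq_eq_sq₀ (norm_nonneg _) (by norm_num), Complex.sq_norm, Complex.normSq_mk]
    linarith
  refine ⟨Complex.arg ⟨c, s⟩, ?_, ?_⟩
  · have := Complex.norm_mul_cos_arg ⟨c, s⟩
    rwa [hn, one_mul] at this
  · have := Complex.norm_mul_sin_arg ⟨c, s⟩
    rwa [hn, one_mul] at this

section
variable (G : Submonoid (Matrix (Fin 2) (Fin 2) ℂ)) (hcl : IsClosed (G : Set (Matrix (Fin 2) (Fin 2) ℂ)))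
  (hH : Hgate ∈ G) (hT : Tgate ∈ G) (hT' : Tgate⁻¹ ∈ G)

include hcl hH hT hT' in
lemma FF_mem (c s : ℝ) (h : c ^ 2 + s ^ 2 = 1) : FF c s ∈ G := by
  have h0 : FF 1 0 = 1 := by
    unfold FF
    ext i j
    fin_cases i <;> fin_cases j <;> simp
  let K : AddSubgroup ℝ :=
    { carrier := {t | FF (Real.cos t) (Real.sin t) ∈ G ∧ FF (Real.cos t) (-Real.sin t) ∈ G}
      zero_mem' := by simp [h0]
      add_mem' := by
        rintro a b ⟨ha, ha'⟩ ⟨hb, hb'⟩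
        constructor
        · have := G.mul_mem ha hb
          rw [FF_mul] at this
          rwa [Real.cos_add, Real.sin_add]
        · have := G.mul_mem ha' hb'
          rw [FF_mul] at this
          rw [Real.cos_add, Real.sin_add]
          convert this using 2 <;> ring
      neg_mem' := by
        rintro a ⟨ha, ha'⟩
        simp [ha, ha'] }
  set w : ℝ := (2 + Real.sqrt 2) / 4 with hw
  have hs2 : Real.sqrt 2 ^ 2 = 2 := Real.sq_sqrt (by norm_num)
  have hA := A_eq
  have hcos : Real.cos (Real.arccos w) = w := by
    have := sqrt2_lt
    have := Real.sqrt_nonneg 2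
    apply Real.cos_arccos <;> linarith
  have hsin : Real.sin (Real.arccos w) = Real.sqrt (10 - 4 * Real.sqrt 2) / 4 := by
    rw [Real.sin_arccos]
    have : 1 - w ^ 2 = (10 - 4 * Real.sqrt 2) / 4 ^ 2 := by
      rw [hw]; linear_combination - hs2 / 16
    rw [this, Real.sqrt_div' _ (by norm_num), Real.sqrt_sq (by norm_num)]
  have hd : Dense (K : Set ℝ) := by
    refine (dense_addSubgroupClosure_pair_iff.2 irr).mono ?_
    rw [SetLike.coe_subset_coe, AddSubgroup.closure_le]
    rintro x (rfl | rfl)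
    · change FF _ _ ∈ G ∧ FF _ _ ∈ G
      rw [hcos, hsin]
      constructor
      · rw [← hA]
        exact G.mul_mem (G.mul_mem (G.mul_mem hT hH) hT') hH
      · have e : Hgate * (Tgate * Hgate * Tgate⁻¹ * Hgate) * Hgate ∈ G := 
          G.mul_mem (G.mul_mem hH (G.mul_mem (G.mul_mem (G.mul_mem hT hH) hT') hH)) hH
        rw [hA, H_conj] at e
        exact e
    · change FF _ _ ∈ G ∧ FF _ _ ∈ G
      simp [h0]
  have hc : IsClosed (K : Set ℝ) := by
    have hcont : Continuous fun x : ℝ × ℝ => FF x.1 x.2 := by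
      unfold FF
      refine continuous_matrix fun i j => ?_
      fin_cases i <;> fin_cases j <;> simp <;> fun_prop
    have e1 : Continuous fun t : ℝ => FF (Real.cos t) (Real.sin t) :=
      hcont.comp (by fun_prop : Continuous fun t : ℝ => (Real.cos t, Real.sin t))
    have e2 : Continuous fun t : ℝ => FF (Real.cos t) (-Real.sin t) :=
      hcont.comp (by fun_prop : Continuous fun t : ℝ => (Real.cos t, -Real.sin t))
    exact (hcl.preimage e1).inter (hcl.preimage e2)
  obtain ⟨t, rfl, rfl⟩ := angle c s h
  have : t ∈ (K : Set ℝ) := by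
    rw [← hc.closure_eq, hd.closure_eq]; trivial
  exact this.1

include hcl hH hT hT' in
lemma DD_mem (x y : ℝ) (h : x ^ 2 + y ^ 2 = 1) :
    DD (x + y * Complex.I) (x - y * Complex.I) ∈ G := by
  have hZ : DD 1 (-1) ∈ G := by
    rw [← T4]; exact G.mul_mem (G.mul_mem hT hT) (G.mul_mem hT hT)
  have hF := FF_mem G hcl hH hT hT'
  obtain ⟨d0, d1⟩ := dd_lt
  let g : ℝ → ℝ := fun t => 1 - 2 * dd * Real.sin t ^ 2
  let σ : ℝ → ℝ := fun t => 2 * Real.sin t * Real.cos t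
  let ρ : ℝ → ℝ := fun t => Real.sqrt (g t ^ 2 + σ t ^ 2)
  have hg : ∀ t, 0 < g t := by
    intro t
    have := Real.sin_sq_le_one t
    simp only [g]
    nlinarith
  have hρ2 : ∀ t, ρ t ^ 2 = g t ^ 2 + σ t ^ 2 := fun t => Real.sq_sqrt (by positivity)
  have hρ : ∀ t, 0 < ρ t := by
    intro t
    have := hg t
    simp only [ρ]
    positivity
  let W : ℝ → ℝ := fun t => (Real.cos t ^ 2 - Real.sin t ^ 2) * (g t / ρ t)
    - 2 * dd * Real.sin t * Real.cos t * (- σ t / ρ t)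
  have hW : Continuous W := by
    have h1 : Continuous g := by fun_prop
    have h2 : Continuous σ := by fun_prop
    have h3 : Continuous ρ := by fun_prop
    have h4 : ∀ t, ρ t ≠ 0 := fun t => (hρ t).ne'
    fun_prop (disch := assumption)
  have hW0 : W 0 = 1 := by
    simp [W, g, σ, ρ]
  have hW1 : W (Real.pi / 2) = -1 := by
    have h2 : |1 - 2 * dd| = 1 - 2 * dd := abs_of_pos (by linarith)
    have h3 : 1 - 2 * dd ≠ 0 := by linarith
    simp [W, g, σ, ρ, h2, Real.sqrt_sq_eq_abs]
    exact h3
  obtain ⟨t, -, ht⟩ : x ∈ W '' Set.Icc 0 (Real.pi / 2) := by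
    apply intermediate_value_Icc' (by positivity) hW.continuousOn
    rw [hW0, hW1]
    constructor <;> nlinarith
  set C := Real.cos t with hC
  set S := Real.sin t with hS
  have hCS : C ^ 2 + S ^ 2 = 1 := by rw [hC, hS]; exact Real.cos_sq_add_sin_sq t
  set c := g t / ρ t with hcdef
  set s := - σ t / ρ t with hsdef
  have hρt := (hρ t).ne'
  have hcs : c ^ 2 + s ^ 2 = 1 := by
    rw [hcdef, hsdef, div_pow, div_pow, neg_sq, ← add_div, ← hρ2]
    exact div_self (pow_ne_zero _ hρt)
  have hcond : 2 * S * C * c + (1 - 2 * dd * S ^ 2) * s = 0 := by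
    change σ t * (g t / ρ t) + g t * (-σ t / ρ t) = 0
    ring
  have hx : (C ^ 2 - S ^ 2) * c - 2 * dd * S * C * s = x := ht
  have k1 := key C S c s hCS hcond
  have k2 := key C (-S) c (-s) (by rw [neg_sq]; exact hCS) (by linear_combination -hcond)
  have m1 : FF C S * (DD 1 (-1) * FF c (-s) * DD 1 (-1)) * FF C S ∈ G :=
    G.mul_mem (G.mul_mem (hF _ _ hCS) (G.mul_mem (G.mul_mem hZ (hF _ _ (by rw [neg_sq]; exact hcs))) hZ))
      (hF _ _ hCS)
  have m2 : FF C (-S) * (DD 1 (-1) * FF c (-(-s)) * DD 1 (-1)) * FF C (-S) ∈ G :=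
    G.mul_mem (G.mul_mem (hF _ _ (by rw [neg_sq]; exact hCS))
      (G.mul_mem (G.mul_mem hZ (hF _ _ (by rw [neg_neg]; exact hcs))) hZ))
      (hF _ _ (by rw [neg_sq]; exact hCS))
  have hdet := congrArg Matrix.det k1
  rw [hx] at k1 hdet
  have hx2 : (C ^ 2 - (-S) ^ 2) * c - 2 * dd * (-S) * C * (-s) = x := by linear_combination hx
  rw [hx2] at k2
  rw [k1] at m1
  rw [k2] at m2
  set V : ℝ := 2 * Real.sqrt 2 * pp * s with hV
  have hV2 : 2 * Real.sqrt 2 * pp * (-s) = -V := by rw [hV]; ring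
  rw [hV2] at m2
  have hxV : x ^ 2 + V ^ 2 = 1 := by
    have e1 : (C : ℂ) ^ 2 + S ^ 2 = 1 := by exact_mod_cast hCS
    have e2 : (c : ℂ) ^ 2 + s ^ 2 = 1 := by exact_mod_cast hcs
    rw [Matrix.det_mul, Matrix.det_mul, Matrix.det_mul, Matrix.det_mul, FF_det, FF_det, e1] at hdet
    simp [DD, e2] at hdet
    have : (x : ℂ) ^ 2 + V ^ 2 = 1 := by
      linear_combination - hdet + V ^ 2 * Complex.I_sq
    exact_mod_cast this
  have : y ^ 2 = V ^ 2 := by linarith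
  rcases sq_eq_sq_iff_eq_or_eq_neg.1 this with rfl | rfl
  · exact m1
  · exact m2

include hcl hH hT hT' in
lemma SU_mem (U : Matrix (Fin 2) (Fin 2) ℂ) (hU : U ∈ Matrix.specialUnitaryGroup (Fin 2) ℂ) :
    U ∈ G := by
  have hD : ∀ t : ℝ, DD (Complex.exp (t * Complex.I)) (Complex.exp (-(t * Complex.I))) ∈ G := by
    intro t
    have := DD_mem G hcl hH hT hT' (Real.cos t) (Real.sin t) (Real.cos_sq_add_sin_sq t)
    convert this using 2
    · rw [Complex.exp_mul_I]; push_cast; rfl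
    · rw [← neg_mul, Complex.exp_mul_I, Complex.cos_neg, Complex.sin_neg]; push_cast; ring
  rw [Matrix.mem_specialUnitaryGroup_iff] at hU
  obtain ⟨hU, hdet⟩ := hU
  have hadj : star U = U.adjugate := by
    have h1 := (Matrix.mem_unitaryGroup_iff').1 hU
    have h2 := Matrix.mul_adjugate U
    rw [hdet, one_smul] at h2
    calc star U = star U * (U * U.adjugate) := by rw [h2, mul_one]
      _ = _ := by rw [← mul_assoc, h1, one_mul]
  have e11 := congrFun (congrFun hadj 0) 0
  have e01 := congrFun (congrFun hadj 1) 0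
  simp [Matrix.adjugate_fin_two, Matrix.star_apply] at e11 e01
  rw [Matrix.det_fin_two] at hdet
  have e10 : U 1 0 = - (starRingEnd ℂ) (U 0 1) := by rw [e01]; ring
  set a := U 0 0 with ha
  set b := U 0 1 with hb
  have hab : ‖a‖ ^ 2 + ‖b‖ ^ 2 = 1 := by
    have h1 := Complex.mul_conj' a
    have h2 := Complex.mul_conj' b
    rw [e10, ← e11] at hdet
    have : (‖a‖ : ℂ) ^ 2 + (‖b‖ : ℂ) ^ 2 = 1 := by
      rw [← hdet, ← h1, ← h2]; ring
    exact_mod_cast this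
  have hR : Hgate * DD (‖a‖ + ‖b‖ * Complex.I) (‖a‖ - ‖b‖ * Complex.I) * Hgate ∈ G :=
    G.mul_mem (G.mul_mem hH (DD_mem G hcl hH hT hT' _ _ hab)) hH
  have hR2 : Hgate * DD (‖a‖ + ‖b‖ * Complex.I) (‖a‖ - ‖b‖ * Complex.I) * Hgate =
      !![(‖a‖ : ℂ), Complex.I * ‖b‖; Complex.I * ‖b‖, (‖a‖ : ℂ)] := by
    rw [H_eq]
    have h1 := rr_sq
    unfold DD
    ext i j
    fin_cases i <;> fin_cases j <;> simp [Matrix.mul_apply, Fin.sum_univ_two] <;> grind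
  rw [hR2] at hR
  let α : ℝ := (Complex.arg a + (Complex.arg b - Real.pi / 2)) / 2
  let γ : ℝ := (Complex.arg a - (Complex.arg b - Real.pi / 2)) / 2
  have hm := G.mul_mem (G.mul_mem (hD α) hR) (hD γ)
  have ea : a = Complex.exp (α * Complex.I) * ‖a‖ * Complex.exp (γ * Complex.I) := by
    conv_lhs => rw [← Complex.norm_mul_exp_arg_mul_I a]
    rw [mul_comm (Complex.exp _) (‖a‖ : ℂ), mul_assoc, ← Complex.exp_add]
    congr 2
    simp only [α, γ]; push_cast; ring
  have eb : b = Complex.exp (α * Complex.I) * (Complex.I * ‖b‖) * Complex.exp (-(γ * Complex.I)) := by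
    conv_lhs => rw [← Complex.norm_mul_exp_arg_mul_I b]
    have e1 : (Complex.arg b : ℂ) * Complex.I =
        α * Complex.I + -(γ * Complex.I) + (Real.pi / 2 : ℂ) * Complex.I := by
      simp only [α, γ]; push_cast; ring
    rw [e1, Complex.exp_add, Complex.exp_add, Complex.exp_pi_div_two_mul_I]
    ring
  have hc1 : ∀ t : ℝ, (starRingEnd ℂ) (Complex.exp (t * Complex.I)) =
      Complex.exp (-(t * Complex.I)) := by
    intro t
    rw [← Complex.exp_conj]; simp
  have hc2 : ∀ t : ℝ, (starRingEnd ℂ) (Complex.exp (-(t * Complex.I))) =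
      Complex.exp (t * Complex.I) := by
    intro t
    rw [← Complex.exp_conj]; simp
  convert hm using 1
  unfold DD
  ext i j
  fin_cases i <;> fin_cases j <;> simp [Matrix.mul_apply, Fin.sum_univ_two]
  · exact ea
  · exact eb
  · rw [e10]
    conv_lhs => rw [eb]
    simp only [map_mul, hc1, hc2, Complex.conj_I, Complex.conj_ofReal]
    ring
  · rw [← e11]
    conv_lhs => rw [ea]
    simp only [map_mul, hc1, Complex.conj_ofReal]

end

/-- `H` and `T` are unitary, and the topological closure of the group they generate
(i.e. of the monoid generated by `H^{±1}` and `T^{±1}`) contains `SU(2)`: every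
`2 × 2` unitary matrix of determinant `1` is a limit of finite products of `H`, `T`
and their inverses. -/
theorem HT_dense_in_SU2 :
    Hgate ∈ Matrix.unitaryGroup (Fin 2) ℂ ∧
    Tgate ∈ Matrix.unitaryGroup (Fin 2) ℂ ∧
    ∀ U ∈ Matrix.specialUnitaryGroup (Fin 2) ℂ,
      U ∈ closure ((Submonoid.closure {Hgate, Tgate, Hgate⁻¹, Tgate⁻¹} :
        Submonoid (Matrix (Fin 2) (Fin 2) ℂ)) : Set (Matrix (Fin 2) (Fin 2) ℂ)) := by
  have hI : Complex.I ^ 2 = -1 := Complex.I_sq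
  have hr := rr_sq
  have hrc : (starRingEnd ℂ) rr = rr := Complex.conj_ofReal _
  refine ⟨?_, ?_, ?_⟩
  · rw [Matrix.mem_unitaryGroup_iff]
    have : star Hgate = Hgate := by
      rw [H_eq]
      ext i j
      fin_cases i <;> fin_cases j <;> simp [Matrix.star_apply, hrc]
    rw [this, H_sq]
  · rw [Matrix.mem_unitaryGroup_iff, T_eq]
    ext i j
    fin_cases i <;> fin_cases j <;>
      simp [Matrix.mul_apply, Fin.sum_univ_two, Matrix.star_apply, hrc]
    grind
  · intro U hU
    let M : Submonoid (Matrix (Fin 2) (Fin 2) ℂ) :=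
      Submonoid.closure {Hgate, Tgate, Hgate⁻¹, Tgate⁻¹}
    have hsub := M.le_topologicalClosure
    refine SU_mem M.topologicalClosure M.isClosed_topologicalClosure ?_ ?_ ?_ U hU <;>
      exact hsub (Submonoid.subset_closure (by simp))
end

section
/- Let ω = e^{2πi/3} and let R be the 9×9 complex matrix, rows and columns indexed by Fin 3 × Fin 3 in lexicographic order, given by R = (i/√3)·M, where M has rows [ω,0,0,0,1,0,0,0,ω], [0,ω,0,0,0,ω,1,0,0], [0,0,ω,ω²,0,0,0,ω²,0], [0,0,ω²,ω,0,0,0,ω²,0], [ω,0,0,0,ω,0,0,0,1], [0,1,0,0,0,ω,ω,0,0], [0,ω,0,0,0,1,ω,0,0], [0,0,ω²,ω²,0,0,0,ω,0], [1,0,0,0,ω,0,0,0,ω]. Then: (a) R is unitary; and (b) R satisfies the Yang–Baxter equation (R ⊗ I₃)(I₃ ⊗ R)(R ⊗ I₃) = (I₃ ⊗ R)(R ⊗ I₃)(I₃ ⊗ R) as matrices indexed by Fin 3 × Fin 3 × Fin 3. Hence R gives an explicit localization of the Jones representations of the braid groups at level 4. -/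
open Matrix

/-- Lexicographic encoding of `Fin 3 × Fin 3` into `Fin 9`. -/
def enc33 : Fin 3 × Fin 3 → Fin 9 :=
  fun p => ⟨3 * p.1.val + p.2.val, by have := p.1.isLt; have := p.2.isLt; omega⟩

/-- `ω = e^{2πi/3}`. -/
noncomputable def ω : ℂ := Complex.exp (2 * Real.pi * Complex.I / 3)

/-- The localizing `R`-matrix of the level-4 Jones representation: `R = (i/√3)·M`
with `M` as displayed, indexed by `Fin 3 × Fin 3` in lexicographic order. -/
noncomputable def RLevel4 : Matrix (Fin 3 × Fin 3) (Fin 3 × Fin 3) ℂ :=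
  fun p q =>
    (Complex.I / ((Real.sqrt 3 : ℝ) : ℂ)) *
      (!![ω, 0, 0, 0, 1, 0, 0, 0, ω;
          0, ω, 0, 0, 0, ω, 1, 0, 0;
          0, 0, ω, ω ^ 2, 0, 0, 0, ω ^ 2, 0;
          0, 0, ω ^ 2, ω, 0, 0, 0, ω ^ 2, 0;
          ω, 0, 0, 0, ω, 0, 0, 0, 1;
          0, 1, 0, 0, 0, ω, ω, 0, 0;
          0, ω, 0, 0, 0, 1, ω, 0, 0;
          0, 0, ω ^ 2, ω ^ 2, 0, 0, 0, ω, 0;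
          1, 0, 0, 0, ω, 0, 0, 0, ω] : Matrix (Fin 9) (Fin 9) ℂ) (enc33 p) (enc33 q)

/-- `R ⊗ I₃`, reassociated to a matrix indexed by `Fin 3 × Fin 3 × Fin 3`. -/
noncomputable def RLevel4_12 : Matrix (Fin 3 × Fin 3 × Fin 3) (Fin 3 × Fin 3 × Fin 3) ℂ :=
  Matrix.reindex (Equiv.prodAssoc (Fin 3) (Fin 3) (Fin 3)) (Equiv.prodAssoc (Fin 3) (Fin 3) (Fin 3))
    (Matrix.kroneckerMap (· * ·) RLevel4 (1 : Matrix (Fin 3) (Fin 3) ℂ))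

/-- `I₃ ⊗ R`, a matrix indexed by `Fin 3 × Fin 3 × Fin 3`. -/
noncomputable def RLevel4_23 : Matrix (Fin 3 × Fin 3 × Fin 3) (Fin 3 × Fin 3 × Fin 3) ℂ :=
  Matrix.kroneckerMap (· * ·) (1 : Matrix (Fin 3) (Fin 3) ℂ) RLevel4

lemma om_cube : ω ^ 3 = 1 := by
  unfold ω
  rw [← Complex.exp_nat_mul]
  have : ((3 : ℕ) : ℂ) * (2 * Real.pi * Complex.I / 3) = 2 * Real.pi * Complex.I := by
    push_cast; ring
  rw [this, Complex.exp_two_pi_mul_I]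

lemma om_ne : ω ≠ 1 := by
  have h := Complex.isPrimitiveRoot_exp 3 (by norm_num)
  have h2 := h.ne_one (by norm_num)
  unfold ω
  simpa using h2

lemma om_quad : ω ^ 2 = -1 - ω := by
  have h : (ω - 1) * (ω ^ 2 + ω + 1) = 0 := by linear_combination om_cube
  rcases mul_eq_zero.1 h with h | h
  · exact absurd (sub_eq_zero.1 h) om_ne
  · linear_combination h

lemma om_star : star ω = ω ^ 2 := by
  have h1 : star ω * ω = 1 := by
    have : ‖ω‖ = 1 := Complex.norm_eq_one_of_pow_eq_one om_cube (by norm_num)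
    rw [Complex.star_def, Complex.conj_mul', this]; simp
  linear_combination ω ^ 2 * h1 - star ω * om_cube

noncomputable def zz (a : ZMod 3) : ℂ := ω ^ a.val

lemma zz_add (a b : ZMod 3) : zz (a + b) = zz a * zz b := by
  unfold zz
  rw [← pow_add, ZMod.val_add]
  conv_rhs => rw [← Nat.div_add_mod (a.val + b.val) 3, pow_add, pow_mul, om_cube, one_pow, one_mul]

lemma zz_zero : zz 0 = 1 := by simp [zz]
lemma zz_one : zz 1 = ω := by
  have : (1 : ZMod 3).val = 1 := rfl
  simp [zz, this]
lemma zz_two : zz 2 = ω ^ 2 := by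
  have : (2 : ZMod 3).val = 2 := rfl
  simp [zz, this]

/-- monomial matrices -/
noncomputable def mon {X : Type} [DecidableEq X] (s : X → X) (e : X → ZMod 3) : Matrix X X ℂ :=
  fun p q => if q = s p then zz (e p) else 0

lemma mon_mul {X : Type} [DecidableEq X] [Fintype X] (s t : X → X) (e f : X → ZMod 3) :
    mon s e * mon t f = mon (fun p => t (s p)) (fun p => e p + f (s p)) := by
  ext p q
  rw [Matrix.mul_apply, Finset.sum_eq_single (s p)]
  · simp [mon, zz_add]
  · intro j _ hj
    simp [mon, hj]
  · simp

lemma mon_smul {X : Type} [DecidableEq X] (t : X → X) (f : X → ZMod 3) :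
    ω • mon t f = mon t (fun p => 1 + f p) := by
  ext p q
  simp [mon, zz_add, zz_one]

lemma mon_one {X : Type} [DecidableEq X] :
    (1 : Matrix X X ℂ) = mon (fun p => p) (fun _ => 0) := by
  ext p q
  simp [mon, zz_zero, Matrix.one_apply, eq_comm]

lemma alg {A : Type} [Ring A] [Algebra ℂ A] (a b : A) (ha : a * (a * a) = 1)
    (hb : b * (b * b) = 1) (hab : a * b = ω • (b * a)) :
    (1 + ω • a + ω • (a * a)) * (1 + ω • b + ω • (b * b)) * (1 + ω • a + ω • (a * a)) =
    (1 + ω • b + ω • (b * b)) * (1 + ω • a + ω • (a * a)) * (1 + ω • b + ω • (b * b)) := by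
  have ha' : ∀ x, a * (a * (a * x)) = x := fun x => by
    rw [← mul_assoc a a x, ← mul_assoc a (a * a) x, ha, one_mul]
  have hb' : ∀ x, b * (b * (b * x)) = x := fun x => by
    rw [← mul_assoc b b x, ← mul_assoc b (b * b) x, hb, one_mul]
  have hab' : ∀ x, a * (b * x) = ω • (b * (a * x)) := fun x => by
    rw [← mul_assoc, hab, smul_mul_assoc, mul_assoc]
  simp only [add_mul, mul_add, one_mul, mul_one, smul_mul_assoc, mul_smul_comm, mul_assoc, hab, hab',
    ha, hb, ha', hb', smul_smul]
  have h2 := om_quad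
  match_scalars <;> grind

def sg : Fin 3 × Fin 3 → Fin 3 × Fin 3 := fun p => (p.1 + 1, p.2 + 1)
def ex : Fin 3 × Fin 3 → ZMod 3 := fun p => if p.1 = p.2 then 1 else if p.2 = p.1 + 1 then 2 else 0
noncomputable def UU : Matrix (Fin 3 × Fin 3) (Fin 3 × Fin 3) ℂ := mon sg ex
noncomputable def kap : ℂ := (Complex.I / ((Real.sqrt 3 : ℝ) : ℂ)) * ω

def ss12 : Fin 3 × Fin 3 × Fin 3 → Fin 3 × Fin 3 × Fin 3 := fun p => (p.1 + 1, p.2.1 + 1, p.2.2)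
def ss23 : Fin 3 × Fin 3 × Fin 3 → Fin 3 × Fin 3 × Fin 3 := fun p => (p.1, p.2.1 + 1, p.2.2 + 1)
def ee12 : Fin 3 × Fin 3 × Fin 3 → ZMod 3 := fun p => ex (p.1, p.2.1)
def ee23 : Fin 3 × Fin 3 × Fin 3 → ZMod 3 := fun p => ex p.2

lemma UU_sq : UU * UU = mon (fun p => (p.1 + 2, p.2 + 2)) (fun p => 2 * ex p) := by
  unfold UU
  rw [mon_mul]
  congr 1
  · decide
  · decide

lemma RL_eq : RLevel4 = kap • (1 + ω • UU + ω • (UU * UU)) := by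
  rw [UU_sq]
  have h3 := om_cube
  have key : ∀ p q : Fin 3 × Fin 3, RLevel4 p q =
      (Complex.I / ((Real.sqrt 3 : ℝ) : ℂ)) * (ω * ((if p = q then 1 else 0)
       + ω * (if q = sg p then zz (ex p) else 0)
       + ω * (if q = (p.1 + 2, p.2 + 2) then zz (2 * ex p) else 0))) := by
    rintro ⟨a, b⟩ ⟨c, d⟩
    unfold RLevel4
    congr 1
    have e : ∀ a b : Fin 3, ex (a, b) = if a = b then 1 else if b = a + 1 then 2 else 0 := by decide
    have e2 : ∀ a b : Fin 3, 2 * ex (a, b) = if a = b then 2 else if b = a + 1 then 1 else 0 := by decide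
    rw [e2, e]
    fin_cases a <;> fin_cases b <;> fin_cases c <;> fin_cases d <;>
      simp [enc33, sg, zz_zero, zz_one, zz_two] <;> grind
  ext p q
  rw [key]
  simp [kap, UU, mon, Matrix.one_apply, mul_assoc]

lemma k12 : RLevel4_12 = kap • (1 + ω • mon ss12 ee12 + ω • (mon ss12 ee12 * mon ss12 ee12)) := by
  unfold RLevel4_12
  rw [RL_eq, UU_sq, mon_mul]
  ext ⟨a, b, c⟩ ⟨a', b', c'⟩
  have h1 : ∀ a : Fin 3, a + 1 + 1 = a + 2 := by decide
  have h2 : ∀ p, ee12 p + ee12 (ss12 p) = 2 * ex (p.1, p.2.1) := by decide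
  simp only [h2]
  by_cases hc : c = c'
  · subst hc
    simp [UU, mon, Matrix.one_apply, ss12, ee12, sg, h1, mul_add]
  · have hc' : ¬ c' = c := fun h => hc h.symm
    simp [UU, mon, Matrix.one_apply, ss12, ee12, sg, h1, hc, hc']

lemma k23 : RLevel4_23 = kap • (1 + ω • mon ss23 ee23 + ω • (mon ss23 ee23 * mon ss23 ee23)) := by
  unfold RLevel4_23
  rw [RL_eq, UU_sq, mon_mul]
  ext ⟨a, b, c⟩ ⟨a', b', c'⟩
  have h1 : ∀ a : Fin 3, a + 1 + 1 = a + 2 := by decide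
  have h2 : ∀ p, ee23 p + ee23 (ss23 p) = 2 * ex p.2 := by decide
  simp only [h2]
  by_cases hc : a = a'
  · subst hc
    simp [UU, mon, Matrix.one_apply, ss23, ee23, sg, h1, mul_add]
  · have hc' : ¬ a' = a := fun h => hc h.symm
    simp [UU, mon, Matrix.one_apply, ss23, ee23, sg, h1, hc, hc']

lemma zz_star (a : ZMod 3) : star (zz a) = zz (2 * a) := by
  have : zz (2 * a) = zz a * zz a := by rw [two_mul, zz_add]
  rw [this]
  unfold zz
  rw [star_pow, om_star]; ring

lemma UU_star : star UU = UU * UU := by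
  rw [UU_sq]
  ext p q
  have h : (p = sg q) ↔ (q = (p.1 + 2, p.2 + 2)) := by revert p q; decide
  have h' : 2 * ex q = 2 * ex p ∨ ¬ (q = (p.1 + 2, p.2 + 2)) := by revert p q; decide
  simp only [UU, mon, Matrix.star_apply]
  by_cases hq : q = (p.1 + 2, p.2 + 2)
  · rw [if_pos hq, if_pos (h.2 hq), zz_star, h'.resolve_right (not_not.2 hq)]
  · rw [if_neg hq, if_neg (fun x => hq (h.1 x)), star_zero]

lemma UU_cube : UU * (UU * UU) = 1 := by
  rw [UU_sq, mon_one]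
  unfold UU
  rw [mon_mul]
  congr 1 <;> decide

lemma kap_star : star kap * kap = 1 / 3 := by
  have h1 : star ω * ω = 1 := by rw [om_star]; linear_combination om_cube
  have h3 : ((Real.sqrt 3 : ℝ) : ℂ) ^ 2 = 3 := by
    rw [← Complex.ofReal_pow, Real.sq_sqrt (by norm_num)]; norm_num
  have h4 : ((Real.sqrt 3 : ℝ) : ℂ) ≠ 0 := by
    intro h; rw [h] at h3; norm_num at h3
  have h5 : star kap = -(Complex.I / ((Real.sqrt 3 : ℝ) : ℂ)) * star ω := by
    simp [kap, neg_div]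
  rw [h5]
  unfold kap
  calc _ = -(Complex.I ^ 2) / ((Real.sqrt 3 : ℝ) : ℂ) ^ 2 * (star ω * ω) := by ring
    _ = _ := by rw [h1, h3, Complex.I_sq]; norm_num

/-- `R` is unitary and satisfies the Yang–Baxter equation, giving an explicit
localization of the level-4 Jones representations of the braid groups. -/
theorem RLevel4_unitary_and_yang_baxter :
    RLevel4 ∈ Matrix.unitaryGroup (Fin 3 × Fin 3) ℂ ∧
    RLevel4_12 * RLevel4_23 * RLevel4_12 = RLevel4_23 * RLevel4_12 * RLevel4_23 := by
  constructor
  · rw [Matrix.mem_unitaryGroup_iff', RL_eq]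
    have hU2 : star (UU * UU) = UU := by rw [← UU_star, star_star]
    have hc' : ∀ x, UU * (UU * (UU * x)) = x := fun x => by
      rw [← mul_assoc UU UU x, ← mul_assoc UU (UU * UU) x, UU_cube, one_mul]
    simp only [star_smul, star_add, star_one, hU2, UU_star, om_star]
    rw [smul_mul_smul_comm, kap_star]
    simp only [add_mul, mul_add, one_mul, mul_one, smul_mul_assoc, mul_smul_comm, mul_assoc,
      UU_cube, hc', smul_smul, smul_add]
    have h2 := om_quad
    match_scalars <;> grind
  · rw [k12, k23]
    simp only [smul_mul_assoc, mul_smul_comm]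
    rw [alg]
    · rw [mon_mul, mon_mul, mon_one]
      congr 1 <;> decide
    · rw [mon_mul, mon_mul, mon_one]
      congr 1 <;> decide
    · rw [mon_mul, mon_mul, mon_smul]
      congr 1 <;> decide
end
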